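/- Let n ≥ 1 be an integer, let V : ℝ → ℝ, and define the radial function U on the open unit ball of ℝ^{n+1} by U(w) = V(log((1 + ‖w‖)/(1 − ‖w‖))). Let θ ∈ ℝ^{n+1} be a unit vector and ξ ∈ ℝ^{n+1} nonzero with ⟨ξ, θ⟩ = 0. Then for every t < −1/2 one has ‖γ(t, ξ, θ)‖ = A(t, ‖ξ‖) < 1 and U(γ(t, ξ, θ)) = V(T(‖ξ‖, t)). Consequently the geodesic X-ray transform of U satisfies X(U)(ξ, θ) = −2 ∫_{−∞}^{−1/2} V(T(‖ξ‖, t))/(1 + 2t) dt; in particular X(U)(ξ, θ) depends only on ‖ξ‖. -/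

import Mathlib

open scoped RealInnerProductSpace

/-- The curve `γ(t, ξ, θ) = θ + (tθ + ξ)/(t² + ‖ξ‖²)`. -/
noncomputable def gammaCurve {n : ℕ} (t : ℝ) (ξ θ : EuclideanSpace ℝ (Fin (n + 1))) :
    EuclideanSpace ℝ (Fin (n + 1)) :=
  θ + (t ^ 2 + ‖ξ‖ ^ 2)⁻¹ • (t • θ + ξ)

/-- The geodesic X-ray transform `X(U)(ξ,θ) = -2∫_{-∞}^{-1/2} U(γ(t,ξ,θ))/(1+2t) dt`. -/
noncomputable def XrayTransform {n : ℕ} (U : EuclideanSpace ℝ (Fin (n + 1)) → ℝ)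
    (ξ θ : EuclideanSpace ℝ (Fin (n + 1))) : ℝ :=
  -2 * ∫ t in Set.Iio (-(1 / 2) : ℝ), U (gammaCurve t ξ θ) / (1 + 2 * t)

/-- `A(t,r) = [((1+t)² + r²)/(t² + r²)]^{1/2}`. -/
noncomputable def Afun (t r : ℝ) : ℝ :=
  Real.sqrt (((1 + t) ^ 2 + r ^ 2) / (t ^ 2 + r ^ 2))

/-- `T(r,t) = log((1 + A(t,r))/(1 - A(t,r)))`. -/
noncomputable def Tfun (r t : ℝ) : ℝ :=
  Real.log ((1 + Afun t r) / (1 - Afun t r))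

/-- For `ξ` orthogonal to the unit vector `θ`, `‖γ(t, ξ, θ)‖ = A(t, ‖ξ‖)`. -/
theorem norm_gammaCurve {n : ℕ} {θ ξ : EuclideanSpace ℝ (Fin (n + 1))} {t : ℝ}
    (hθ : ‖θ‖ = 1) (horth : ⟪ξ, θ⟫ = 0) (hs : 0 < t ^ 2 + ‖ξ‖ ^ 2) :
    ‖gammaCurve t ξ θ‖ = Afun t ‖ξ‖ := by
  unfold Afun gammaCurve
  rw [eq_comm, Real.sqrt_eq_iff_eq_sq (by positivity) (norm_nonneg _)]
  have horth' : ⟪θ, ξ⟫ = 0 := by rw [real_inner_comm, horth]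
  rw [← real_inner_self_eq_norm_sq (θ + _)]
  simp only [inner_add_left, inner_add_right, real_inner_smul_left, real_inner_smul_right,
    horth, horth']
  simp only [real_inner_self_eq_norm_sq, hθ]
  field_simp
  ring

/-- `A(t, r) < 1` for `t < -1/2`. -/
theorem Afun_lt_one {t : ℝ} (r : ℝ) (ht : t < -(1 / 2)) : Afun t r < 1 := by
  have hs : 0 < t ^ 2 + r ^ 2 := by nlinarith [sq_nonneg r]
  rw [Afun, Real.sqrt_lt' one_pos, one_pow, div_lt_one hs]
  nlinarith

/-- For the radial function `U(w) = V(log((1+‖w‖)/(1-‖w‖)))` one has, along the geodesic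
`γ(·,ξ,θ)` with `t < -1/2`: `‖γ‖ = A(t,‖ξ‖) < 1` and `U(γ) = V(T(‖ξ‖,t))`; hence the
X-ray transform of `U` is `-2∫ V(T(‖ξ‖,t))/(1+2t) dt`, depending only on `‖ξ‖`. -/
theorem stmt_17 (n : ℕ) (hn : 1 ≤ n) (V : ℝ → ℝ)
    (U : EuclideanSpace ℝ (Fin (n + 1)) → ℝ)
    (hU : ∀ w : EuclideanSpace ℝ (Fin (n + 1)), ‖w‖ < 1 →
      U w = V (Real.log ((1 + ‖w‖) / (1 - ‖w‖))))
    (θ ξ : EuclideanSpace ℝ (Fin (n + 1)))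
    (hθ : ‖θ‖ = 1) (hξ : ξ ≠ 0) (horth : ⟪ξ, θ⟫ = 0) :
    (∀ t : ℝ, t < -(1 / 2) →
      ‖gammaCurve t ξ θ‖ = Afun t ‖ξ‖ ∧ Afun t ‖ξ‖ < 1 ∧
      U (gammaCurve t ξ θ) = V (Tfun ‖ξ‖ t)) ∧
    XrayTransform U ξ θ = -2 * ∫ t in Set.Iio (-(1 / 2) : ℝ), V (Tfun ‖ξ‖ t) / (1 + 2 * t) := by
  have key (t : ℝ) (ht : t < -(1 / 2)) :
      ‖gammaCurve t ξ θ‖ = Afun t ‖ξ‖ ∧ Afun t ‖ξ‖ < 1 ∧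
        U (gammaCurve t ξ θ) = V (Tfun ‖ξ‖ t) := by
    have hnorm := norm_gammaCurve (t := t) hθ horth
      (by have := norm_pos_iff.mpr hξ; positivity)
    have hlt := Afun_lt_one ‖ξ‖ ht
    refine ⟨hnorm, hlt, ?_⟩
    rw [hU _ (hnorm ▸ hlt), hnorm, Tfun]
  refine ⟨key, ?_⟩
  rw [XrayTransform]
  congr 1
  refine MeasureTheory.setIntegral_congr_fun measurableSet_Iio fun t ht => ?_
  simp only [(key t ht).2.2]
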